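/- Fix (θ, β) ∈ (0,1)² and α > 0 such that α > η^clu_θ(β). Then for every sequence of measurable clustering procedures ℓ̂ = ℓ̂^{(p)} : ℝ^{n×p} → {−1,1}^n, liminf_{p→∞} Hamm_p(ℓ̂) ≥ 1/2. -/

import Mathlib

open MeasureTheory ProbabilityTheory Filter
open scoped ENNReal NNReal Classical BigOperators

namespace ARWPaper

/-- `n = ⌈p^θ⌉`. -/
noncomputable def nDim (p : ℕ) (θ : ℝ) : ℕ := ⌈(p : ℝ) ^ θ⌉₊

/-- Law of a single class label: uniform on `{-1, 1}`. -/
noncomputable def signLaw : Measure ℝ :=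
  (1 / 2 : ℝ≥0∞) • Measure.dirac (1 : ℝ) + (1 / 2 : ℝ≥0∞) • Measure.dirac (-1 : ℝ)

/-- Law of a single coordinate of `μ`: `τ` w.p. `ε`, `0` w.p. `1 - ε`. -/
noncomputable def muLaw (ε τ : ℝ) : Measure ℝ :=
  ENNReal.ofReal (1 - ε) • Measure.dirac (0 : ℝ) + ENNReal.ofReal ε • Measure.dirac τ

/-- Standard Gaussian product measure on `ℝ^n`. -/
noncomputable def gaussPi (n : ℕ) : Measure (Fin n → ℝ) :=
  Measure.pi fun _ => gaussianReal 0 1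

/-- Law of the noise matrix `Z` (i.i.d. `N(0,1)` entries, rows indexed by `Fin n`). -/
noncomputable def noiseLaw (n p : ℕ) : Measure (Fin n → Fin p → ℝ) :=
  Measure.pi fun _ => gaussPi p

/-- Sample space for `(ℓ, μ, Z)`. -/
abbrev Omega (n p : ℕ) := (Fin n → ℝ) × (Fin p → ℝ) × (Fin n → Fin p → ℝ)

/-- Joint law of `(ℓ, μ, Z)`. -/
noncomputable def jointLaw (n p : ℕ) (ε τ : ℝ) : Measure (Omega n p) :=
  (Measure.pi fun _ : Fin n => signLaw).prod
    ((Measure.pi fun _ : Fin p => muLaw ε τ).prod (noiseLaw n p))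

/-- Data matrix `X = ℓ μ' + Z`. -/
def dataMap {n p : ℕ} (ω : Omega n p) : Fin n → Fin p → ℝ :=
  fun i j => ω.1 i * ω.2.1 j + ω.2.2 i j

/-- Hamming clustering error of a clustering procedure `ell`, where the observed data
matrix is `D ω`. -/
noncomputable def hammingClu (n p : ℕ) (ε τ : ℝ)
    (D : Omega n p → Fin n → Fin p → ℝ)
    (ell : (Fin n → Fin p → ℝ) → Fin n → ℝ) : ℝ :=
  (n : ℝ)⁻¹ * min
    (∑ i : Fin n, ((jointLaw n p ε τ) {ω | ell (D ω) i ≠ ω.1 i}).toReal)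
    (∑ i : Fin n, ((jointLaw n p ε τ) {ω | ell (D ω) i ≠ -ω.1 i}).toReal)

/-- Hamming error for signal (support) recovery. -/
noncomputable def hammingSig (n p : ℕ) (ε τ : ℝ)
    (D : Omega n p → Fin n → Fin p → ℝ)
    (S : (Fin n → Fin p → ℝ) → Finset (Fin p)) : ℝ :=
  ((p : ℝ) * ε)⁻¹ * ∑ j : Fin p,
    (((jointLaw n p ε τ) {ω | ω.2.1 j = 0 ∧ j ∈ S (D ω)}).toReal +
      ((jointLaw n p ε τ) {ω | ω.2.1 j ≠ 0 ∧ j ∉ S (D ω)}).toReal)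

/-- Sum of type I and type II testing errors of the rejection region `R`. -/
noncomputable def testErr (n p : ℕ) (ε τ : ℝ)
    (R : Set (Fin n → Fin p → ℝ)) : ℝ :=
  ((noiseLaw n p) R).toReal + ((jointLaw n p ε τ) {ω | dataMap ω ∉ R}).toReal

/-- Statistical boundary for clustering. -/
noncomputable def etaClu (θ β : ℝ) : ℝ :=
  if β < (1 - θ) / 2 then (1 - 2 * β) / 2
  else if β < 1 - θ then θ / 2
  else (1 - β) / 2

/-- CTUB boundary for clustering. -/
noncomputable def etaCluT (θ β : ℝ) : ℝ :=
  if β < (1 - θ) / 2 then (1 - 2 * β) / 2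
  else if β < 1 / 2 then (1 + θ - 2 * β) / 4
  else if β < 1 - θ / 2 then θ / 4
  else (1 - β) / 2

/-- Statistical boundary for signal recovery. -/
noncomputable def etaSig (θ β : ℝ) : ℝ :=
  if β < 1 - θ then θ / 2 else (1 + θ - β) / 4

/-- CTUB boundary for signal recovery. -/
noncomputable def etaSigT (θ β : ℝ) : ℝ :=
  if β < (1 - θ) / 2 then θ / 2
  else if β < 1 / 2 then (1 + θ - 2 * β) / 4
  else θ / 4

noncomputable def etaHyp1 (θ β : ℝ) : ℝ := (2 + θ - 4 * β) / 4
noncomputable def etaHyp2 (θ β : ℝ) : ℝ := min (θ / 2) ((1 + θ - β) / 4)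
noncomputable def etaHyp (θ β : ℝ) : ℝ := max (etaHyp1 θ β) (etaHyp2 θ β)
noncomputable def etaHypT (θ β : ℝ) : ℝ := max (etaHyp1 θ β) (θ / 4)

/-- Standard phase function `ρ*`. -/
noncomputable def rhoStar (b : ℝ) : ℝ :=
  if b < 3 / 4 then b - 1 / 2 else (1 - Real.sqrt (1 - b)) ^ 2

/-- Phase function for IF-PCA. -/
noncomputable def rhoStarTheta (θ β : ℝ) : ℝ :=
  (1 - θ) * rhoStar (1 / 2 + (β - 1 / 2) / (1 - θ))

/-- Euclidean norm of a vector. -/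
noncomputable def l2 {n : ℕ} (v : Fin n → ℝ) : ℝ := Real.sqrt (∑ i, v i ^ 2)

/-- Entrywise sup-norm of a vector. -/
noncomputable def linf {n : ℕ} (v : Fin n → ℝ) : ℝ := ⨆ i, |v i|

/-- `cos(x, y) = |⟨x/‖x‖, y/‖y‖⟩|`. -/
noncomputable def cosv {n : ℕ} (x y : Fin n → ℝ) : ℝ :=
  |∑ i, x i * y i| / (l2 x * l2 y)

/-- Spectral (operator) norm of a matrix. -/
noncomputable def specNorm {m k : ℕ} (A : Matrix (Fin m) (Fin k) ℝ) : ℝ :=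
  sSup ((fun v => l2 (A.mulVec v)) '' {v | l2 v ≤ 1})

/-- Simple Aggregation clustering: entrywise sign of the sum of all columns. -/
noncomputable def ellSimpleAgg {n p : ℕ} (X : Fin n → Fin p → ℝ) : Fin n → ℝ :=
  fun i => Real.sign (∑ j, X i j)

/-- `S` picks, for every data matrix, a size-`N` subset maximizing `‖∑_{j ∈ S} x_j‖₁`. -/
def IsSparseAggMaximizer {n p : ℕ} (N : ℕ)
    (S : (Fin n → Fin p → ℝ) → Finset (Fin p)) : Prop :=
  ∀ X, (S X).card = N ∧
    ∀ T : Finset (Fin p), T.card = N →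
      ∑ i, |∑ j ∈ T, X i j| ≤ ∑ i, |∑ j ∈ S X, X i j|

/-- Sparse Aggregation clustering. -/
noncomputable def ellSparseAgg {n p : ℕ}
    (S : (Fin n → Fin p → ℝ) → Finset (Fin p)) (X : Fin n → Fin p → ℝ) :
    Fin n → ℝ :=
  fun i => Real.sign (∑ j ∈ S X, X i j)

/-- Gram matrix `X X'`. -/
def gram {n p : ℕ} (X : Fin n → Fin p → ℝ) : Matrix (Fin n) (Fin n) ℝ :=
  Matrix.of fun i i' => ∑ j, X i j * X i' j

/-- `ξ` is a unit eigenvector of `A` associated with its largest eigenvalue. -/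
def IsTopEigenvector {n : ℕ} (A : Matrix (Fin n) (Fin n) ℝ) (ξ : Fin n → ℝ) : Prop :=
  (∑ i, ξ i ^ 2) = 1 ∧
    ∃ lam : ℝ, A.mulVec ξ = lam • ξ ∧
      ∀ (lam' : ℝ) (v : Fin n → ℝ), v ≠ 0 → A.mulVec v = lam' • v → lam' ≤ lam

/-- χ²-screening: the set of selected features. -/
noncomputable def chiSel {n p : ℕ} (q : ℝ) (X : Fin n → Fin p → ℝ) : Finset (Fin p) :=
  Finset.univ.filter fun j =>
    Real.sqrt (2 * q * Real.log p) ≤ ((∑ i, X i j ^ 2) - n) / Real.sqrt (2 * n)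

/-- Post-selection Gram matrix `X^{(q)} (X^{(q)})'`. -/
noncomputable def gramSel {n p : ℕ} (q : ℝ) (X : Fin n → Fin p → ℝ) :
    Matrix (Fin n) (Fin n) ℝ :=
  Matrix.of fun i i' => ∑ j ∈ chiSel q X, X i j * X i' j

/-- IF-PCA calibration `τ_p* = p^{-θ/4} (4 r log p)^{1/4}`. -/
noncomputable def tauStar (p : ℕ) (θ r : ℝ) : ℝ :=
  (p : ℝ) ^ (-(θ / 4)) * (4 * r * Real.log p) ^ ((1 : ℝ) / 4)

/-- The ideal threshold `q*` of IF-PCA in the Region of Possibility. -/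
noncomputable def qStar (θ β r : ℝ) : ℝ :=
  if (β - θ / 2) / 3 < r then (β - θ / 2 + r) ^ 2 / (4 * r) else 4 * r

/-- Support of `μ`. -/
noncomputable def suppSet {p : ℕ} (μ : Fin p → ℝ) : Finset (Fin p) :=
  Finset.univ.filter fun j => μ j ≠ 0

/-- The event `D_p`: `| |S(μ)| - p ε_p | ≤ √(6 p ε_p log p)` with `ε_p = p^{-β}`. -/
def inDp (β : ℝ) {p : ℕ} (μ : Fin p → ℝ) : Prop :=
  |((suppSet μ).card : ℝ) - (p : ℝ) * (p : ℝ) ^ (-β)| ≤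
    Real.sqrt (6 * ((p : ℝ) * (p : ℝ) ^ (-β)) * Real.log p)

/-- Selection threshold `n + 2√(q n log p)` for the squared column norm. -/
noncomputable def thresh (p n : ℕ) (q : ℝ) : ℝ :=
  (n : ℝ) + 2 * Real.sqrt (q * n * Real.log p)

/-- `π₀ = P(‖z‖² > n + 2√(q n log p))`, `z ~ N(0, I_n)`. -/
noncomputable def pi0 (p n : ℕ) (q : ℝ) : ℝ :=
  ((gaussPi n) {z | thresh p n q < ∑ i, z i ^ 2}).toReal

/-- `π₁ = P(‖z + τ ℓ‖² > n + 2√(q n log p))`, `z ~ N(0, I_n)`. -/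
noncomputable def pi1 (p : ℕ) {n : ℕ} (q τ : ℝ) (ℓ : Fin n → ℝ) : ℝ :=
  ((gaussPi n) {z | thresh p n q < ∑ i, (z i + τ * ℓ i) ^ 2}).toReal

/-- Expected number of selected useless features (`s = |S(μ)|`). -/
noncomputable def m0q (p n : ℕ) (q : ℝ) (s : ℕ) : ℝ := ((p : ℝ) - s) * pi0 p n q

/-- Expected number of selected useful features. -/
noncomputable def m1q (p : ℕ) {n : ℕ} (q τ : ℝ) (ℓ : Fin n → ℝ) (s : ℕ) : ℝ :=
  (s : ℝ) * pi1 p q τ ℓ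

/-- `m^{(q)}`. -/
noncomputable def mq (p : ℕ) {n : ℕ} (q τ : ℝ) (ℓ : Fin n → ℝ) (s : ℕ) : ℝ :=
  m0q p n q s + m1q p q τ ℓ s

/-- `m_*^{(q)}`. -/
noncomputable def mstarq (p : ℕ) {n : ℕ} (q τ : ℝ) (ℓ : Fin n → ℝ) (s : ℕ) : ℝ :=
  ((p : ℝ) - s) * (n : ℝ)⁻¹ *
      (∫ z in {z : Fin n → ℝ | thresh p n q < ∑ i, z i ^ 2}, (∑ i, z i ^ 2) ∂gaussPi n) +
    (s : ℝ) * (n : ℝ)⁻¹ *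
      (∫ z in {z : Fin n → ℝ | thresh p n q < ∑ i, (z i + τ * ℓ i) ^ 2},
        (∑ i, z i ^ 2) ∂gaussPi n)

/-- The threshold `q̃(β, θ, r)` separating the "fat" and "skinny" cases. -/
noncomputable def qTilde (β θ r : ℝ) : ℝ :=
  if β < 1 - θ then max (1 - θ) ((Real.sqrt (1 - β - θ) + Real.sqrt r) ^ 2)
  else 1 - θ

/-- The set of features selected by χ²-screening, in terms of `(ℓ, μ, Z)`. -/
noncomputable def selSet {n p : ℕ} (q : ℝ) (ℓ : Fin n → ℝ) (μ : Fin p → ℝ)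
    (Z : Fin n → Fin p → ℝ) : Finset (Fin p) :=
  chiSel q fun i j => ℓ i * μ j + Z i j

/-- `Z^{(q)} (Z^{(q)})'`. -/
noncomputable def gramZq {n p : ℕ} (q : ℝ) (ℓ : Fin n → ℝ) (μ : Fin p → ℝ)
    (Z : Fin n → Fin p → ℝ) : Matrix (Fin n) (Fin n) ℝ :=
  Matrix.of fun i i' => ∑ j ∈ selSet q ℓ μ Z, Z i j * Z i' j

/-- `X^{(q)} (X^{(q)})'`. -/
noncomputable def gramXq {n p : ℕ} (q : ℝ) (ℓ : Fin n → ℝ) (μ : Fin p → ℝ)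
    (Z : Fin n → Fin p → ℝ) : Matrix (Fin n) (Fin n) ℝ :=
  Matrix.of fun i i' =>
    ∑ j ∈ selSet q ℓ μ Z, (ℓ i * μ j + Z i j) * (ℓ i' * μ j + Z i' j)

/-- The matrix `ℓ (μ^{(q)})' (Z^{(q)})' + Z^{(q)} μ^{(q)} ℓ'`. -/
noncomputable def crossMat {n p : ℕ} (q : ℝ) (ℓ : Fin n → ℝ) (μ : Fin p → ℝ)
    (Z : Fin n → Fin p → ℝ) : Matrix (Fin n) (Fin n) ℝ :=
  Matrix.of fun i i' =>
    ℓ i * (∑ j ∈ selSet q ℓ μ Z, Z i' j * μ j) +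
      (∑ j ∈ selSet q ℓ μ Z, Z i j * μ j) * ℓ i'

/-- Colored-noise data matrix `X = ℓ μ' + A Z B`. -/
noncomputable def dataColored {n p : ℕ} (A : Matrix (Fin n) (Fin n) ℝ)
    (B : Matrix (Fin p) (Fin p) ℝ) (ω : Omega n p) : Fin n → Fin p → ℝ :=
  fun i j => ω.1 i * ω.2.1 j + (A * Matrix.of ω.2.2 * B) i j

/-- Colored-noise data matrix `X = ℓ μ' + Z B`. -/
noncomputable def dataColoredB {n p : ℕ} (B : Matrix (Fin p) (Fin p) ℝ)
    (ω : Omega n p) : Fin n → Fin p → ℝ :=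
  fun i j => ω.1 i * ω.2.1 j + (Matrix.of ω.2.2 * B) i j

/-- `y_*^{(sa)} = n^{-1/2} X' ℓ̂_*^{(sa)}`. -/
noncomputable def ySA {n p : ℕ} (X : Fin n → Fin p → ℝ) : Fin p → ℝ :=
  fun j => (Real.sqrt n)⁻¹ * ∑ i, X i j * ellSimpleAgg X i

/-- `Ŝ_*^{(sa)}`: thresholding `y_*^{(sa)}` at the universal threshold. -/
noncomputable def ShatSA {n p : ℕ} (X : Fin n → Fin p → ℝ) : Finset (Fin p) :=
  Finset.univ.filter fun j => Real.sqrt (2 * Real.log p) ≤ |ySA X j|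

/-- `y_*^{(if)} = n^{-1/2} X' sgn(ξ)` for a given vector `ξ`. -/
noncomputable def yIF {n p : ℕ} (ξ : Fin n → ℝ) (X : Fin n → Fin p → ℝ) : Fin p → ℝ :=
  fun j => (Real.sqrt n)⁻¹ * ∑ i, X i j * Real.sign (ξ i)

/-- `Ŝ_*^{(if)}`: thresholding `y_*^{(if)}` at the universal threshold. -/
noncomputable def ShatIF {n p : ℕ} (ξ : Fin n → ℝ) (X : Fin n → Fin p → ℝ) : Finset (Fin p) :=
  Finset.univ.filter fun j => Real.sqrt (2 * Real.log p) ≤ |yIF ξ X j|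

/-- Rejection region of the Simple Aggregation test `T̂_*^{(sa)}`. -/
noncomputable def rejSA {n p : ℕ} : Set (Fin n → Fin p → ℝ) :=
  {X | 2 * Real.sqrt (2 * Real.log p) ≤
    ((p : ℝ) * (∑ i, ((p : ℝ)⁻¹ * ∑ j, X i j) ^ 2) - n) / Real.sqrt (2 * n)}

/-- Rejection region of the Sparse Aggregation test `T̂_N^{(sa)}`. -/
noncomputable def rejSparse {n p : ℕ} (N : ℕ)
    (S : (Fin n → Fin p → ℝ) → Finset (Fin p)) : Set (Fin n → Fin p → ℝ) :=
  {X | Real.sqrt (2 / Real.pi) * n + Real.sqrt (2 * n * (N + 2) * Real.log p) ≤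
    (Real.sqrt N)⁻¹ * ∑ i, |∑ j ∈ S X, X i j|}

/-- χ² P-value of feature `j`. -/
noncomputable def pvalue {n p : ℕ} (X : Fin n → Fin p → ℝ) (j : Fin p) : ℝ :=
  ((gaussPi n) {z | (∑ i, X i j ^ 2) ≤ ∑ i, z i ^ 2}).toReal

/-- Higher Criticism statistic. -/
noncomputable def HCstat {n p : ℕ} (X : Fin n → Fin p → ℝ) : ℝ :=
  sSup {h : ℝ | ∃ i : Fin p, 2 * (i.val + 1) ≤ p ∧
    h = Real.sqrt p * (((i.val : ℝ) + 1) / p - pvalue X (Tuple.sort (pvalue X) i)) /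
      Real.sqrt (pvalue X (Tuple.sort (pvalue X) i) *
        (1 - pvalue X (Tuple.sort (pvalue X) i)))}

/-- Rejection region of the Higher Criticism test. -/
noncomputable def rejHC {n p : ℕ} : Set (Fin n → Fin p → ℝ) :=
  {X | 2 * Real.sqrt (2 * Real.log (Real.log p)) ≤ HCstat X}

/-- Lebesgue measure on the space of `n × p` matrices. -/
noncomputable def lebPi (n p : ℕ) : Measure (Fin n → Fin p → ℝ) :=
  Measure.pi fun _ : Fin n => Measure.pi fun _ : Fin p => (volume : Measure ℝ)

/-- Law of `X` in Experiment 1 (`X = ℓ μ' + c_p Z`) with `ℓ_i` forced to be `s`. -/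
noncomputable def condLaw1 (n p : ℕ) (ε τ cp : ℝ) (i : Fin n) (s : ℝ) :
    Measure (Fin n → Fin p → ℝ) :=
  (jointLaw n p ε τ).map fun ω => fun i' j =>
    Function.update ω.1 i s i' * ω.2.1 j + cp * ω.2.2 i' j

/-- Law of `X` in Experiment 2 (`X = ℓ μ' + c_p Z + W`) with `ℓ_i` forced to be `s`,
where `W ~ ν` is independent of `(ℓ, μ, Z)`. -/
noncomputable def condLaw2 (n p : ℕ) (ε τ cp : ℝ)
    (ν : Measure (Fin n → Fin p → ℝ)) (i : Fin n) (s : ℝ) :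
    Measure (Fin n → Fin p → ℝ) :=
  ((jointLaw n p ε τ).prod ν).map fun ωw => fun i' j =>
    Function.update ωw.1.1 i s i' * ωw.1.2.1 j + cp * ωw.1.2.2 i' j + ωw.2 i' j

end ARWPaper

namespace ARWPaper

theorem pi_withDensity_ofReal {ι E : Type*} [Fintype ι] [MeasurableSpace E]
    (μ : ι → Measure E) [∀ i, IsProbabilityMeasure (μ i)] (f : ι → E → ℝ)
    (hnn : ∀ i x, 0 ≤ f i x) (hfi : ∀ i, Integrable (f i) (μ i)) :
    Measure.pi (fun i => (μ i).withDensity fun x => ENNReal.ofReal (f i x)) =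
      (Measure.pi μ).withDensity fun x => ENNReal.ofReal (∏ i, f i (x i)) := by
  have hfin : ∀ i, IsFiniteMeasure ((μ i).withDensity fun x => ENNReal.ofReal (f i x)) :=
    fun i => isFiniteMeasure_withDensity_ofReal (hfi i).2
  refine Measure.pi_eq fun s hs => ?_
  rw [withDensity_apply _ (MeasurableSet.univ_pi hs), Measure.restrict_pi_pi,
    ← ofReal_integral_eq_lintegral_ofReal
      (Integrable.fintype_prod_dep fun i => (hfi i).restrict)
      (ae_of_all _ fun x => Finset.prod_nonneg fun i _ => hnn i _),
    integral_fintype_prod_eq_prod,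
    ENNReal.ofReal_prod_of_nonneg fun i _ => integral_nonneg (hnn i)]
  refine Finset.prod_congr rfl fun i _ => ?_
  rw [withDensity_apply _ (hs i), ofReal_integral_eq_lintegral_ofReal (hfi i).restrict
    (ae_of_all _ (hnn i))]

instance isProbabilityMeasure_gaussPi (n : ℕ) : IsProbabilityMeasure (gaussPi n) := by
  unfold gaussPi; infer_instance

instance isProbabilityMeasure_noiseLaw (n p : ℕ) : IsProbabilityMeasure (noiseLaw n p) := by
  unfold noiseLaw; infer_instance

instance isProbabilityMeasure_signLaw : IsProbabilityMeasure signLaw := by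
  refine ⟨?_⟩
  simp [signLaw, ENNReal.inv_two_add_inv_two]

theorem isProbabilityMeasure_muLaw {ε : ℝ} (τ : ℝ) (h0 : 0 ≤ ε) (h1 : ε ≤ 1) :
    IsProbabilityMeasure (muLaw ε τ) := by
  refine ⟨?_⟩
  simp [muLaw, ← ENNReal.ofReal_add (sub_nonneg.2 h1) h0]

theorem noiseLaw_map_transpose (n p : ℕ) :
    (noiseLaw n p).map (fun X j i => X i j) = Measure.pi fun _ : Fin p => gaussPi n := by
  have h1 := Measure.infinitePi_map_curry_symm (ι := Fin n) (κ := Fin p)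
    (μ := fun _ _ => gaussianReal 0 1)
  have h2 := Measure.infinitePi_map_curry (ι := Fin p) (κ := Fin n)
    (μ := fun _ _ => gaussianReal 0 1)
  have h3 := Measure.infinitePi_map_piCongrLeft
    (μ := fun _ : Fin p × Fin n => gaussianReal 0 1) (Equiv.prodComm (Fin n) (Fin p))
  simp only [Measure.infinitePi_eq_pi] at h1 h2 h3
  unfold noiseLaw gaussPi
  rw [← h2, ← h3, ← h1, Measure.map_map (by fun_prop) (by fun_prop),
    Measure.map_map (by fun_prop) (by fun_prop)]
  rfl

/-- The likelihood ratio of `N(v, I)` with respect to `N(0, I)`. -/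
noncomputable def gaussTilt {n : ℕ} (v x : Fin n → ℝ) : ℝ :=
  Real.exp (∑ i, v i * x i - (∑ i, v i ^ 2) / 2)

theorem integrable_exp_linear {n : ℕ} (v : Fin n → ℝ) :
    Integrable (fun x => Real.exp (∑ i, v i * x i)) (gaussPi n) := by
  simp only [Real.exp_sum]
  exact Integrable.fintype_prod (f := fun i y => Real.exp (v i * y))
    fun i => integrable_exp_mul_gaussianReal _

theorem integral_exp_linear {n : ℕ} (v : Fin n → ℝ) :
    ∫ x, Real.exp (∑ i, v i * x i) ∂gaussPi n = Real.exp ((∑ i, v i ^ 2) / 2) := by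
  simp only [Real.exp_sum, Finset.sum_div]
  rw [gaussPi, integral_fintype_prod_eq_prod (f := fun i y => Real.exp (v i * y))]
  refine Finset.prod_congr rfl fun i _ => ?_
  have := congrFun (mgf_fun_id_gaussianReal (μ := 0) (v := 1)) (v i)
  simpa [mgf] using this

theorem gaussPi_map_add {n : ℕ} (v : Fin n → ℝ) :
    (gaussPi n).map (fun z i => v i + z i) =
      (gaussPi n).withDensity fun x => ENNReal.ofReal (gaussTilt v x) := by
  have key : ∀ m : ℝ, (gaussianReal 0 1).map (m + ·) =
      (gaussianReal 0 1).withDensity fun y => ENNReal.ofReal (Real.exp (m * y - m ^ 2 / 2)) := by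
    intro m
    rw [gaussianReal_map_const_add, gaussianReal_of_var_ne_zero _ one_ne_zero,
      gaussianReal_of_var_ne_zero _ one_ne_zero,
      ← withDensity_mul _ (by fun_prop) (by fun_prop)]
    congr 1
    ext y
    simp only [Pi.mul_apply, gaussianPDF]
    rw [← ENNReal.ofReal_mul (gaussianPDFReal_nonneg _ _ _)]
    congr 1
    simp only [gaussianPDFReal]
    rw [mul_assoc _ (Real.exp _) (Real.exp _), ← Real.exp_add]
    congr 2
    push_cast
    ring
  have hfi : ∀ i, Integrable (fun y => Real.exp (v i * y - v i ^ 2 / 2)) (gaussianReal 0 1) := by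
    intro i
    simp only [Real.exp_sub]
    exact (integrable_exp_mul_gaussianReal _).div_const _
  unfold gaussPi
  rw [Measure.pi_map_pi (f := fun i y => v i + y) (fun i => by fun_prop)]
  simp only [key]
  rw [pi_withDensity_ofReal (fun _ => gaussianReal 0 1)
    (fun i y => Real.exp (v i * y - v i ^ 2 / 2)) (fun _ _ => (Real.exp_pos _).le) hfi]
  simp only [gaussTilt, ← Real.exp_sum, Finset.sum_sub_distrib, Finset.sum_div]

/-- The likelihood ratio of the law of one column of the data matrix. -/
noncomputable def colDensity {n : ℕ} (ε : ℝ) (v x : Fin n → ℝ) : ℝ :=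
  1 - ε + ε * gaussTilt v x

theorem gaussTilt_pos {n : ℕ} (v x : Fin n → ℝ) : 0 < gaussTilt v x := Real.exp_pos _

theorem measurable_gaussTilt {n : ℕ} (v : Fin n → ℝ) : Measurable (gaussTilt v) := by
  unfold gaussTilt; fun_prop

theorem integrable_gaussTilt {n : ℕ} (v : Fin n → ℝ) :
    Integrable (gaussTilt v) (gaussPi n) := by
  unfold gaussTilt
  simp only [Real.exp_sub]
  exact (integrable_exp_linear v).div_const _

theorem integral_gaussTilt {n : ℕ} (v : Fin n → ℝ) : ∫ x, gaussTilt v x ∂gaussPi n = 1 := by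
  simp only [gaussTilt, Real.exp_sub]
  rw [integral_div, integral_exp_linear, div_self (Real.exp_pos _).ne']

theorem integrable_colDensity {n : ℕ} (ε : ℝ) (v : Fin n → ℝ) :
    Integrable (colDensity ε v) (gaussPi n) :=
  (integrable_const _).add ((integrable_gaussTilt v).const_mul ε)

theorem integral_colDensity {n : ℕ} (ε : ℝ) (v : Fin n → ℝ) :
    ∫ x, colDensity ε v x ∂gaussPi n = 1 := by
  simp only [colDensity]
  rw [integral_add (integrable_const _) ((integrable_gaussTilt v).const_mul ε),
    integral_const_mul, integral_gaussTilt]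
  simp

theorem colLaw_eq_withDensity {n : ℕ} {ε : ℝ} (τ : ℝ) (h0 : 0 ≤ ε) (h1 : ε ≤ 1)
    (l : Fin n → ℝ) :
    ((muLaw ε τ).prod (gaussPi n)).map (fun w i => l i * w.1 + w.2 i) =
      (gaussPi n).withDensity fun x =>
        ENNReal.ofReal (colDensity ε (fun i => τ * l i) x) := by
  have := isProbabilityMeasure_muLaw τ h0 h1
  have hshift := gaussPi_map_add fun i => τ * l i
  ext s hs
  have hs' : MeasurableSet ((fun (w : ℝ × (Fin n → ℝ)) i => l i * w.1 + w.2 i) ⁻¹' s) :=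
    (by fun_prop : Measurable fun (w : ℝ × (Fin n → ℝ)) i => l i * w.1 + w.2 i) hs
  have ht : gaussPi n ((fun z i => τ * l i + z i) ⁻¹' s) =
      ∫⁻ x in s, ENNReal.ofReal (gaussTilt (fun i => τ * l i) x) ∂gaussPi n := by
    rw [← withDensity_apply _ hs, ← hshift, Measure.map_apply (by fun_prop) hs]
  rw [Measure.map_apply (by fun_prop) hs, Measure.prod_apply hs', withDensity_apply _ hs, muLaw,
    lintegral_add_measure, lintegral_smul_measure, lintegral_smul_measure,
    lintegral_dirac, lintegral_dirac]
  have e0 : Prod.mk (0 : ℝ) ⁻¹' ((fun (w : ℝ × (Fin n → ℝ)) i => l i * w.1 + w.2 i) ⁻¹' s) = s := by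
    ext z; simp
  have e1 : Prod.mk τ ⁻¹' ((fun (w : ℝ × (Fin n → ℝ)) i => l i * w.1 + w.2 i) ⁻¹' s) =
      (fun z i => τ * l i + z i) ⁻¹' s := by
    ext z; simp [mul_comm τ]
  rw [e0, e1, ht]
  have hd : ∀ x, ENNReal.ofReal (colDensity ε (fun i => τ * l i) x) =
      ENNReal.ofReal (1 - ε) +
        ENNReal.ofReal ε * ENNReal.ofReal (gaussTilt (fun i => τ * l i) x) := by
    intro x
    rw [colDensity, ENNReal.ofReal_add (sub_nonneg.2 h1)
      (mul_nonneg h0 (gaussTilt_pos _ _).le), ENNReal.ofReal_mul h0]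
  simp only [hd]
  rw [lintegral_add_left measurable_const, lintegral_const_mul _
    (measurable_gaussTilt _).ennreal_ofReal]
  simp

theorem dataLaw_map_transpose {n p : ℕ} {ε : ℝ} (τ : ℝ) (h0 : 0 ≤ ε) (h1 : ε ≤ 1)
    (l : Fin n → ℝ) :
    ((Measure.pi fun _ : Fin p => muLaw ε τ).prod (noiseLaw n p)).map
        (fun w j i => l i * w.1 j + w.2 i j) =
      Measure.pi fun _ : Fin p => (gaussPi n).withDensity fun x =>
        ENNReal.ofReal (colDensity ε (fun i => τ * l i) x) := by
  have := isProbabilityMeasure_muLaw τ h0 h1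
  have hT : MeasurePreserving (fun (X : Fin n → Fin p → ℝ) j i => X i j) (noiseLaw n p)
      (Measure.pi fun _ : Fin p => gaussPi n) := ⟨by fun_prop, noiseLaw_map_transpose n p⟩
  have hA := (measurePreserving_arrowProdEquivProdArrow ℝ (Fin n → ℝ) (Fin p)
    (fun _ => muLaw ε τ) (fun _ => gaussPi n)).symm
  have hB := hA.comp ((MeasurePreserving.id (Measure.pi fun _ : Fin p => muLaw ε τ)).prod hT)
  simp only [← colLaw_eq_withDensity τ h0 h1]
  rw [← Measure.pi_map_pi (f := fun _ (w : ℝ × (Fin n → ℝ)) i => l i * w.1 + w.2 i)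
    (fun i => by fun_prop), ← hB.map_eq, Measure.map_map (by fun_prop) hB.measurable]
  rfl

/-- A `χ²`-type bound on the difference of two product measures. The function `h` dominates
`f ^ 2 / g`. -/
theorem pi_withDensity_le_add {Ω : Type*} [MeasurableSpace Ω] (γ : Measure Ω)
    [IsProbabilityMeasure γ] {f g h : Ω → ℝ} (hf0 : ∀ x, 0 ≤ f x) (hg0 : ∀ x, 0 < g x)
    (hfg : ∀ x, f x ^ 2 ≤ g x * h x) (hf : Integrable f γ) (hg : Integrable g γ)
    (hh : Integrable h γ) (hf1 : ∫ x, f x ∂γ = 1) (hg1 : ∫ x, g x ∂γ = 1) {c : ℝ}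
    (hh1 : ∫ x, h x ∂γ ≤ 1 + c) {p : ℕ} {A : Set (Fin p → Ω)} (hA : MeasurableSet A)
    {t : ℝ} (ht : 0 < t) :
    (Measure.pi fun _ : Fin p => γ.withDensity fun x => ENNReal.ofReal (f x)).real A ≤
      (Measure.pi fun _ : Fin p => γ.withDensity fun x => ENNReal.ofReal (g x)).real A +
        (t / 2 + ((1 + c) ^ p - 1) / (2 * t)) := by
  have hh0 : ∀ x, 0 ≤ h x := fun x =>
    nonneg_of_mul_nonneg_right ((sq_nonneg _).trans (hfg x)) (hg0 x)
  have hreal : ∀ {u : Ω → ℝ}, (∀ x, 0 ≤ u x) → Integrable u γ →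
      (Measure.pi fun _ : Fin p => γ.withDensity fun x => ENNReal.ofReal (u x)).real A =
        ∫ x in A, ∏ j, u (x j) ∂Measure.pi fun _ : Fin p => γ := by
    intro u hu0 hu
    rw [pi_withDensity_ofReal (fun _ : Fin p => γ) (fun _ => u) (fun _ => hu0) (fun _ => hu),
      measureReal_def, withDensity_apply _ hA,
      integral_eq_lintegral_of_nonneg_ae
        (ae_of_all _ fun x => Finset.prod_nonneg fun i _ => hu0 _)
        (Integrable.fintype_prod (f := fun _ => u) fun _ => hu).integrableOn.1]
  have hprod : ∀ u : Ω → ℝ, ∫ x, ∏ j, u (x j) ∂(Measure.pi fun _ : Fin p => γ) =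
      (∫ x, u x ∂γ) ^ p := by
    intro u
    rw [integral_fintype_prod_eq_pow, Fintype.card_fin]
  have iF : Integrable (fun x => ∏ j, f (x j)) (Measure.pi fun _ : Fin p => γ) :=
    Integrable.fintype_prod (f := fun _ => f) fun _ => hf
  have iG : Integrable (fun x => ∏ j, g (x j)) (Measure.pi fun _ : Fin p => γ) :=
    Integrable.fintype_prod (f := fun _ => g) fun _ => hg
  have iH : Integrable (fun x => ∏ j, h (x j)) (Measure.pi fun _ : Fin p => γ) :=
    Integrable.fintype_prod (f := fun _ => h) fun _ => hh
  set D : (Fin p → Ω) → ℝ := fun x => ((t ^ 2 + 1) * ∏ j, g (x j) - 2 * ∏ j, f (x j) +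
    ∏ j, h (x j)) / (2 * t) with hD
  have iD : Integrable D (Measure.pi fun _ : Fin p => γ) :=
    (((iG.const_mul _).sub (iF.const_mul _)).add iH).div_const _
  have hFGH : ∀ x : Fin p → Ω, (∏ j, f (x j)) ^ 2 ≤ (∏ j, g (x j)) * ∏ j, h (x j) := by
    intro x
    rw [← Finset.prod_pow, ← Finset.prod_mul_distrib]
    exact Finset.prod_le_prod (fun _ _ => sq_nonneg _) fun _ _ => hfg _
  have hGpos : ∀ x : Fin p → Ω, 0 < ∏ j, g (x j) := fun x => Finset.prod_pos fun _ _ => hg0 _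
  have hD0 : ∀ x, 0 ≤ D x := by
    intro x
    refine div_nonneg ?_ (by positivity)
    have h1 := hFGH x
    have h2 := hGpos x
    refine nonneg_of_mul_nonneg_right (a := ∏ j, g (x j)) ?_ h2
    nlinarith [sq_nonneg (∏ j, f (x j) - ∏ j, g (x j)), sq_nonneg (t * ∏ j, g (x j))]
  have hpt : ∀ x : Fin p → Ω, ∏ j, f (x j) ≤ ∏ j, g (x j) + D x := by
    intro x
    have h1 := hFGH x
    have h2 := hGpos x
    rw [← sub_le_iff_le_add', hD, le_div_iff₀ (by positivity)]
    refine le_of_mul_le_mul_left (a := ∏ j, g (x j)) ?_ h2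
    nlinarith [sq_nonneg (∏ j, f (x j) - ∏ j, g (x j) - t * ∏ j, g (x j))]
  have hDint : ∫ x, D x ∂(Measure.pi fun _ : Fin p => γ) ≤ t / 2 + ((1 + c) ^ p - 1) / (2 * t) := by
    have e : ∫ x, D x ∂(Measure.pi fun _ : Fin p => γ) =
        ((t ^ 2 + 1) - 2 + (∫ x, h x ∂γ) ^ p) / (2 * t) := by
      have iGF : Integrable (fun x => (t ^ 2 + 1) * ∏ j, g (x j) - 2 * ∏ j, f (x j))
          (Measure.pi fun _ : Fin p => γ) := (iG.const_mul _).sub (iF.const_mul _)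
      rw [hD, integral_div, integral_add iGF iH,
        integral_sub (iG.const_mul _) (iF.const_mul _), integral_const_mul, integral_const_mul,
        hprod, hprod, hprod, hf1, hg1]
      simp
    rw [e]
    have hpow : (∫ x, h x ∂γ) ^ p ≤ (1 + c) ^ p :=
      pow_le_pow_left₀ (integral_nonneg hh0) hh1 p
    have e2 : t / 2 + ((1 + c) ^ p - 1) / (2 * t) = ((t ^ 2 + 1) - 2 + (1 + c) ^ p) / (2 * t) := by
      field_simp
      ring
    rw [e2]
    gcongr
  rw [hreal hf0 hf, hreal (fun x => (hg0 x).le) hg]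
  calc ∫ x in A, ∏ j, f (x j) ∂(Measure.pi fun _ : Fin p => γ)
      ≤ ∫ x in A, (∏ j, g (x j) + D x) ∂(Measure.pi fun _ : Fin p => γ) :=
        integral_mono iF.integrableOn (iG.add iD).integrableOn hpt
    _ = ∫ x in A, ∏ j, g (x j) ∂(Measure.pi fun _ : Fin p => γ) +
        ∫ x in A, D x ∂(Measure.pi fun _ : Fin p => γ) :=
        integral_add iG.integrableOn iD.integrableOn
    _ ≤ _ := by
        gcongr
        exact (setIntegral_le_integral iD (ae_of_all _ hD0)).trans hDint

theorem colDensity_pos {n : ℕ} {ε : ℝ} (h0 : 0 ≤ ε) (h1 : ε < 1) (v x : Fin n → ℝ) :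
    0 < colDensity ε v x := by
  have := mul_nonneg h0 (gaussTilt_pos v x).le
  unfold colDensity
  linarith

theorem gaussTilt_mul {n : ℕ} (v w x : Fin n → ℝ) :
    gaussTilt v x * gaussTilt w x =
      Real.exp (∑ i, v i * w i) * gaussTilt (fun i => v i + w i) x := by
  simp only [gaussTilt, ← Real.exp_add]
  congr 1
  simp only [add_mul, add_sq, Finset.sum_add_distrib, mul_assoc, ← Finset.mul_sum]
  ring

theorem gaussTilt_sq_div {n : ℕ} (v w x : Fin n → ℝ) :
    gaussTilt v x ^ 2 / gaussTilt w x =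
      Real.exp (∑ i, (v i - w i) ^ 2) * gaussTilt (fun i => 2 * v i - w i) x := by
  simp only [gaussTilt, ← Real.exp_add, ← Real.exp_nat_mul, ← Real.exp_sub]
  congr 1
  simp only [sub_mul, sub_sq, mul_pow, Finset.sum_sub_distrib, Finset.sum_add_distrib, mul_assoc,
    ← Finset.mul_sum]
  push_cast
  ring

/-- Total variation bound when the useful features are too rare to be exploited. -/
theorem colDensity_pi_le_of_rare {n p : ℕ} {ε : ℝ} (h0 : 0 < ε) (h1 : ε < 1) (v w : Fin n → ℝ)
    {A : Set (Fin p → Fin n → ℝ)} (hA : MeasurableSet A) {t : ℝ} (ht : 0 < t) :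
    (Measure.pi fun _ : Fin p => (gaussPi n).withDensity fun x =>
        ENNReal.ofReal (colDensity ε v x)).real A ≤
      (Measure.pi fun _ : Fin p => (gaussPi n).withDensity fun x =>
        ENNReal.ofReal (colDensity ε w x)).real A +
        (t / 2 + ((1 + ε * (Real.exp (∑ i, (v i - w i) ^ 2) - 1)) ^ p - 1) / (2 * t)) := by
  have i2 : Integrable (fun x => gaussTilt v x ^ 2 / gaussTilt w x) (gaussPi n) := by
    simp only [gaussTilt_sq_div]
    exact (integrable_gaussTilt _).const_mul _
  have h_int : ∫ x, gaussTilt v x ^ 2 / gaussTilt w x ∂gaussPi n =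
      Real.exp (∑ i, (v i - w i) ^ 2) := by
    simp only [gaussTilt_sq_div]
    rw [integral_const_mul, integral_gaussTilt, mul_one]
  refine pi_withDensity_le_add (gaussPi n)
    (h := fun x => 1 - ε + ε * (gaussTilt v x ^ 2 / gaussTilt w x))
    (fun x => (colDensity_pos h0.le h1 v x).le)
    (fun x => colDensity_pos h0.le h1 w x) ?_ (integrable_colDensity _ _)
    (integrable_colDensity _ _) ((integrable_const _).add (i2.const_mul _))
    (integral_colDensity _ _) (integral_colDensity _ _) (le_of_eq ?_) hA ht
  · intro x
    have hv := gaussTilt_pos v x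
    have hw := gaussTilt_pos w x
    simp only [colDensity]
    set a := gaussTilt v x
    set b := gaussTilt w x
    rw [← sub_nonneg]
    have : (1 - ε + ε * b) * (1 - ε + ε * (a ^ 2 / b)) - (1 - ε + ε * a) ^ 2 =
        ε * (1 - ε) * ((a - b) ^ 2 / b) := by
      field_simp
      ring
    rw [this]
    have := sub_pos.2 h1
    positivity
  · rw [integral_add (integrable_const _) (i2.const_mul _), integral_const_mul, h_int]
    simp
    ring

/-- Total variation bound when the useful features are too weak to be located. -/
theorem colDensity_pi_le_of_weak {n p : ℕ} {ε : ℝ} (h0 : 0 < ε) (h1 : ε < 1) (v w : Fin n → ℝ)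
    {A : Set (Fin p → Fin n → ℝ)} (hA : MeasurableSet A) {t : ℝ} (ht : 0 < t) :
    (Measure.pi fun _ : Fin p => (gaussPi n).withDensity fun x =>
        ENNReal.ofReal (colDensity ε v x)).real A ≤
      (Measure.pi fun _ : Fin p => (gaussPi n).withDensity fun x =>
        ENNReal.ofReal (colDensity ε w x)).real A +
        (t / 2 + ((1 + ε ^ 2 / (1 - ε) * (Real.exp (∑ i, v i * v i) + Real.exp (∑ i, w i * w i) -
          2 * Real.exp (∑ i, v i * w i))) ^ p - 1) / (2 * t)) := by
  have key : ∀ x, (gaussTilt v x - gaussTilt w x) ^ 2 =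
      Real.exp (∑ i, v i * v i) * gaussTilt (fun i => v i + v i) x +
      Real.exp (∑ i, w i * w i) * gaussTilt (fun i => w i + w i) x -
      2 * Real.exp (∑ i, v i * w i) * gaussTilt (fun i => v i + w i) x := by
    intro x
    rw [mul_assoc, ← gaussTilt_mul, ← gaussTilt_mul, ← gaussTilt_mul]
    ring
  have i1 := (integrable_gaussTilt (fun i => v i + v i)).const_mul (Real.exp (∑ i, v i * v i))
  have i2 := (integrable_gaussTilt (fun i => w i + w i)).const_mul (Real.exp (∑ i, w i * w i))
  have i3 := (integrable_gaussTilt (fun i => v i + w i)).const_mul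
    (2 * Real.exp (∑ i, v i * w i))
  have isq : Integrable (fun x => (gaussTilt v x - gaussTilt w x) ^ 2) (gaussPi n) := by
    simp only [key]
    exact (i1.add i2).sub i3
  have hsq : ∫ x, (gaussTilt v x - gaussTilt w x) ^ 2 ∂gaussPi n =
      Real.exp (∑ i, v i * v i) + Real.exp (∑ i, w i * w i) - 2 * Real.exp (∑ i, v i * w i) := by
    simp only [key]
    have i12 : Integrable (fun x => Real.exp (∑ i, v i * v i) * gaussTilt (fun i => v i + v i) x +
        Real.exp (∑ i, w i * w i) * gaussTilt (fun i => w i + w i) x) (gaussPi n) := i1.add i2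
    rw [integral_sub i12 i3, integral_add i1 i2, integral_const_mul, integral_const_mul,
      integral_const_mul, integral_gaussTilt, integral_gaussTilt, integral_gaussTilt]
    ring
  have iv := integrable_colDensity ε v
  have iw := integrable_colDensity ε w
  have hε := sub_pos.2 h1
  refine pi_withDensity_le_add (gaussPi n)
    (h := fun x => 2 * colDensity ε v x - colDensity ε w x +
      ε ^ 2 / (1 - ε) * (gaussTilt v x - gaussTilt w x) ^ 2)
    (fun x => (colDensity_pos h0.le h1 v x).le)
    (fun x => colDensity_pos h0.le h1 w x) ?_ iv iw
    (((iv.const_mul 2).sub iw).add (isq.const_mul _))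
    (integral_colDensity _ _) (integral_colDensity _ _) (le_of_eq ?_) hA ht
  · intro x
    have hw := mul_pos h0 (gaussTilt_pos w x)
    simp only [colDensity]
    set a := gaussTilt v x
    set b := gaussTilt w x
    rw [← sub_nonneg]
    have : (1 - ε + ε * b) * (2 * (1 - ε + ε * a) - (1 - ε + ε * b) +
        ε ^ 2 / (1 - ε) * (a - b) ^ 2) - (1 - ε + ε * a) ^ 2 =
        (ε * b) * (ε ^ 2 / (1 - ε) * (a - b) ^ 2) := by
      field_simp
      ring
    rw [this]
    positivity
  · have ivw : Integrable (fun x => 2 * colDensity ε v x - colDensity ε w x) (gaussPi n) :=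
      (iv.const_mul 2).sub iw
    rw [integral_add ivw (isq.const_mul _),
      integral_sub (iv.const_mul 2) iw, integral_const_mul, integral_const_mul, hsq,
      integral_colDensity, integral_colDensity]
    ring

/-- The conditional probability, given the labels `l`, that the data matrix lies in `A`. -/
noncomputable def condProb (n p : ℕ) (ε τ : ℝ) (l : Fin n → ℝ) (A : Set (Fin n → Fin p → ℝ)) : ℝ :=
  ((Measure.pi fun _ : Fin p => muLaw ε τ).prod (noiseLaw n p)).real
    {w | (fun i j => l i * w.1 j + w.2 i j) ∈ A}

/-- Change the sign of the `i`-th label. -/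
def flipLabel {n : ℕ} (i : Fin n) (l : Fin n → ℝ) : Fin n → ℝ :=
  fun k => if k = i then -l k else l k

theorem measurePreserving_flipLabel {n : ℕ} (i : Fin n) :
    MeasurePreserving (flipLabel i) (Measure.pi fun _ : Fin n => signLaw)
      (Measure.pi fun _ : Fin n => signLaw) := by
  have hneg : MeasurePreserving (fun x : ℝ => -x) signLaw signLaw := by
    refine ⟨measurable_neg, ?_⟩
    rw [signLaw, Measure.map_add _ _ measurable_neg, Measure.map_smul, Measure.map_smul,
      Measure.map_dirac, Measure.map_dirac, neg_neg, add_comm]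
  refine measurePreserving_pi _ _ (f := fun k x => if k = i then -x else x) fun k => ?_
  by_cases hk : k = i
  · simpa [hk] using hneg
  · simp only [hk, if_false]
    exact MeasurePreserving.id signLaw

theorem ae_signLaw_pi (n : ℕ) :
    ∀ᵐ l ∂(Measure.pi fun _ : Fin n => signLaw), ∀ i, l i = 1 ∨ l i = -1 := by
  have h : ∀ᵐ x ∂signLaw, x = 1 ∨ x = -1 := by
    rw [signLaw, ae_add_measure_iff]
    constructor
    · refine Measure.ae_smul_measure ?_ _
      rw [ae_dirac_eq]
      simp
    · refine Measure.ae_smul_measure ?_ _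
      rw [ae_dirac_eq]
      simp
  exact ae_all_iff.2 fun i =>
    (measurePreserving_eval (fun _ : Fin n => signLaw) i).quasiMeasurePreserving.ae h

/-- If flipping one label barely changes the law of the data, then that label is misclassified
with probability about one half, up to either choice `s` of the global sign. -/
theorem half_sub_le_misclassification {n p : ℕ} {ε τ δ : ℝ} (h0 : 0 ≤ ε) (h1 : ε ≤ 1)
    (hδ : 0 ≤ δ) (i : Fin n)
    (hTV : ∀ l : Fin n → ℝ, (∀ k, l k = 1 ∨ l k = -1) → ∀ A, MeasurableSet A →
      condProb n p ε τ l A ≤ condProb n p ε τ (flipLabel i l) A + δ)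
    (ell : (Fin n → Fin p → ℝ) → Fin n → ℝ) (hmeas : Measurable ell)
    (hval : ∀ X k, ell X k = 1 ∨ ell X k = -1) {s : ℝ} (hs : s = 1 ∨ s = -1) :
    1 / 2 - δ / 2 ≤ (jointLaw n p ε τ {ω | ell (dataMap ω) i ≠ s * ω.1 i}).toReal := by
  have := isProbabilityMeasure_muLaw τ h0 h1
  have hell : Measurable fun X => ell X i := (measurable_pi_apply i).comp hmeas
  have hdata : Measurable (dataMap : Omega n p → Fin n → Fin p → ℝ) := by
    unfold dataMap; fun_prop
  have hE : MeasurableSet {ω : Omega n p | ell (dataMap ω) i ≠ s * ω.1 i} :=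
    (measurableSet_eq_fun (hell.comp hdata) (by fun_prop)).compl
  set ν := (Measure.pi fun _ : Fin p => muLaw ε τ).prod (noiseLaw n p)
  set Q : (Fin n → ℝ) → ℝ≥0∞ := fun l =>
    ν (Prod.mk l ⁻¹' {ω : Omega n p | ell (dataMap ω) i ≠ s * ω.1 i}) with hQ
  have hQm : Measurable Q := measurable_measure_prodMk_left hE
  have hJ : jointLaw n p ε τ {ω | ell (dataMap ω) i ≠ s * ω.1 i} =
      ∫⁻ l, Q l ∂(Measure.pi fun _ : Fin n => signLaw) := by
    rw [jointLaw, Measure.prod_apply hE]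
  have hJ' : jointLaw n p ε τ {ω | ell (dataMap ω) i ≠ s * ω.1 i} =
      ∫⁻ l, Q (flipLabel i l) ∂(Measure.pi fun _ : Fin n => signLaw) := by
    rw [hJ, (measurePreserving_flipLabel i).lintegral_comp hQm]
  have hpt : ∀ᵐ l ∂(Measure.pi fun _ : Fin n => signLaw),
      1 ≤ Q l + Q (flipLabel i l) + ENNReal.ofReal δ := by
    filter_upwards [ae_signLaw_pi n] with l hl
    have hA : MeasurableSet {X : Fin n → Fin p → ℝ | ell X i = s * l i} :=
      measurableSet_eq_fun hell measurable_const
    set B : Set ((Fin p → ℝ) × (Fin n → Fin p → ℝ)) :=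
      {w | (fun k j => l k * w.1 j + w.2 k j) ∈ {X : Fin n → Fin p → ℝ | ell X i = s * l i}}
    have hB : MeasurableSet B :=
      (by fun_prop : Measurable fun (w : (Fin p → ℝ) × (Fin n → Fin p → ℝ)) k j =>
        l k * w.1 j + w.2 k j) hA
    have e1 : Q l = ν Bᶜ := rfl
    have e2 : Q (flipLabel i l) = ENNReal.ofReal
        (condProb n p ε τ (flipLabel i l) {X | ell X i = s * l i}) := by
      rw [condProb, ofReal_measureReal, hQ]
      refine congrArg ν (Set.ext fun w => ?_)
      have hfl : flipLabel i l i = -l i := by simp [flipLabel]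
      have h2 := hval (fun k j => flipLabel i l k * w.1 j + w.2 k j) i
      change ell (fun k j => flipLabel i l k * w.1 j + w.2 k j) i ≠ s * flipLabel i l i ↔
        ell (fun k j => flipLabel i l k * w.1 j + w.2 k j) i = s * l i
      rw [hfl]
      generalize ell (fun k j => flipLabel i l k * w.1 j + w.2 k j) i = y at h2 ⊢
      rcases hs with rfl | rfl <;> rcases hl i with h | h <;> rcases h2 with rfl | rfl <;>
        rw [h] <;> norm_num
    have e3 : ν B = ENNReal.ofReal (condProb n p ε τ l {X | ell X i = s * l i}) := by
      rw [condProb, ofReal_measureReal]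
    calc (1 : ℝ≥0∞) = ν B + ν Bᶜ := by rw [measure_add_measure_compl hB, measure_univ]
      _ ≤ (Q (flipLabel i l) + ENNReal.ofReal δ) + Q l := by
        rw [e1, e2, e3, ← ENNReal.ofReal_add (by unfold condProb; exact measureReal_nonneg) hδ]
        gcongr
        exact hTV l hl _ hA
      _ = _ := by ring
  have hsum : (1 : ℝ≥0∞) ≤ jointLaw n p ε τ {ω | ell (dataMap ω) i ≠ s * ω.1 i} +
      jointLaw n p ε τ {ω | ell (dataMap ω) i ≠ s * ω.1 i} + ENNReal.ofReal δ := by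
    calc (1 : ℝ≥0∞) = ∫⁻ _, 1 ∂(Measure.pi fun _ : Fin n => signLaw) := by simp
      _ ≤ ∫⁻ l, (Q l + Q (flipLabel i l) + ENNReal.ofReal δ)
          ∂(Measure.pi fun _ : Fin n => signLaw) := lintegral_mono_ae hpt
      _ = _ := by
        rw [lintegral_add_right _ measurable_const, lintegral_add_left hQm, ← hJ, ← hJ']
        simp
  have hfin : jointLaw n p ε τ {ω | ell (dataMap ω) i ≠ s * ω.1 i} ≠ ⊤ := by
    have : IsProbabilityMeasure (jointLaw n p ε τ) := by unfold jointLaw; infer_instance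
    exact measure_ne_top _ _
  have := ENNReal.toReal_mono (by finiteness) hsum
  rw [ENNReal.toReal_add (by finiteness) (by finiteness), ENNReal.toReal_add hfin hfin,
    ENNReal.toReal_ofReal hδ, ENNReal.toReal_one] at this
  linarith

theorem half_sub_le_hammingClu {n p : ℕ} {ε τ δ : ℝ} (hn : 0 < n) (h0 : 0 ≤ ε) (h1 : ε ≤ 1)
    (hδ : 0 ≤ δ)
    (hTV : ∀ i : Fin n, ∀ l : Fin n → ℝ, (∀ k, l k = 1 ∨ l k = -1) → ∀ A, MeasurableSet A →
      condProb n p ε τ l A ≤ condProb n p ε τ (flipLabel i l) A + δ)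
    (ell : (Fin n → Fin p → ℝ) → Fin n → ℝ) (hmeas : Measurable ell)
    (hval : ∀ X k, ell X k = 1 ∨ ell X k = -1) :
    1 / 2 - δ / 2 ≤ hammingClu n p ε τ dataMap ell := by
  have hn' : (0 : ℝ) < n := Nat.cast_pos.2 hn
  rw [hammingClu, ← div_eq_inv_mul, le_div_iff₀ hn']
  refine le_min ?_ ?_
  · have := Finset.card_nsmul_le_sum Finset.univ
      (fun i : Fin n => (jointLaw n p ε τ {ω | ell (dataMap ω) i ≠ ω.1 i}).toReal)
      (1 / 2 - δ / 2) fun i _ => by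
        simpa using half_sub_le_misclassification h0 h1 hδ i (hTV i) ell hmeas hval
          (s := 1) (Or.inl rfl)
    simpa [mul_comm] using this
  · have := Finset.card_nsmul_le_sum Finset.univ
      (fun i : Fin n => (jointLaw n p ε τ {ω | ell (dataMap ω) i ≠ -ω.1 i}).toReal)
      (1 / 2 - δ / 2) fun i _ => by
        simpa using half_sub_le_misclassification h0 h1 hδ i (hTV i) ell hmeas hval
          (s := -1) (Or.inr rfl)
    simpa [mul_comm] using this

theorem hammingClu_le_one {n p : ℕ} {ε τ : ℝ} (h0 : 0 ≤ ε) (h1 : ε ≤ 1)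
    (D : Omega n p → Fin n → Fin p → ℝ) (ell : (Fin n → Fin p → ℝ) → Fin n → ℝ) :
    hammingClu n p ε τ D ell ≤ 1 := by
  have := isProbabilityMeasure_muLaw τ h0 h1
  have : IsProbabilityMeasure (jointLaw n p ε τ) := by unfold jointLaw; infer_instance
  have hle : ∑ i : Fin n, (jointLaw n p ε τ {ω | ell (D ω) i ≠ ω.1 i}).toReal ≤ n := by
    calc _ ≤ ∑ _ : Fin n, (1 : ℝ) := Finset.sum_le_sum fun i _ => measureReal_le_one
      _ = n := by simp
  rw [hammingClu, ← div_eq_inv_mul]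
  exact div_le_one_of_le₀ ((min_le_left _ _).trans hle) (Nat.cast_nonneg n)

theorem condProb_eq {n p : ℕ} {ε : ℝ} (τ : ℝ) (h0 : 0 ≤ ε) (h1 : ε ≤ 1) (l : Fin n → ℝ)
    {A : Set (Fin n → Fin p → ℝ)} (hA : MeasurableSet A) :
    condProb n p ε τ l A = (Measure.pi fun _ : Fin p => (gaussPi n).withDensity fun x =>
      ENNReal.ofReal (colDensity ε (fun i => τ * l i) x)).real
        ((fun (Y : Fin p → Fin n → ℝ) i j => Y j i) ⁻¹' A) := by
  rw [← dataLaw_map_transpose τ h0 h1, measureReal_def, Measure.map_apply (by fun_prop)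
    ((by fun_prop : Measurable fun (Y : Fin p → Fin n → ℝ) i j => Y j i) hA)]
  rfl

section flip

variable {n : ℕ} {τ : ℝ} {l : Fin n → ℝ}

theorem sum_flipLabel_sub_sq (hl : ∀ k, l k = 1 ∨ l k = -1) (i : Fin n) :
    ∑ k, (τ * l k - τ * flipLabel i l k) ^ 2 = 4 * τ ^ 2 := by
  rw [Finset.sum_eq_single i]
  · rcases hl i with h | h <;> simp [flipLabel, h] <;> ring
  · intro k _ hk
    simp [flipLabel, hk]
  · simp

theorem flipLabel_eq_or (hl : ∀ k, l k = 1 ∨ l k = -1) (i : Fin n) (k : Fin n) :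
    flipLabel i l k = 1 ∨ flipLabel i l k = -1 := by
  by_cases hk : k = i
  · rcases hl k with h | h <;> simp [flipLabel, ← hk, h]
  · simpa [flipLabel, hk] using hl k

theorem sum_label_mul_self (hl : ∀ k, l k = 1 ∨ l k = -1) :
    ∑ k, τ * l k * (τ * l k) = n * τ ^ 2 := by
  have : ∀ k, τ * l k * (τ * l k) = τ ^ 2 := fun k => by rcases hl k with h | h <;> simp [h, sq]
  simp [this]

theorem sum_label_mul_flipLabel (hl : ∀ k, l k = 1 ∨ l k = -1) (i : Fin n) :
    ∑ k, τ * l k * (τ * flipLabel i l k) = n * τ ^ 2 - 2 * τ ^ 2 := by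
  have h1 := sum_flipLabel_sub_sq (τ := τ) hl i
  have h2 := sum_label_mul_self (τ := τ) hl
  have h3 := sum_label_mul_self (τ := τ) (flipLabel_eq_or hl i)
  have : ∀ k, (τ * l k - τ * flipLabel i l k) ^ 2 = τ * l k * (τ * l k) +
      τ * flipLabel i l k * (τ * flipLabel i l k) - 2 * (τ * l k * (τ * flipLabel i l k)) :=
    fun k => by ring
  simp only [this, Finset.sum_add_distrib, Finset.sum_sub_distrib, ← Finset.mul_sum, h2, h3] at h1
  linarith

end flip

theorem condProb_le_flipLabel_of_rare {n p : ℕ} {ε τ : ℝ} (h0 : 0 < ε) (h1 : ε < 1) (i : Fin n)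
    {l : Fin n → ℝ} (hl : ∀ k, l k = 1 ∨ l k = -1) {A : Set (Fin n → Fin p → ℝ)}
    (hA : MeasurableSet A) {t : ℝ} (ht : 0 < t) :
    condProb n p ε τ l A ≤ condProb n p ε τ (flipLabel i l) A +
      (t / 2 + ((1 + ε * (Real.exp (4 * τ ^ 2) - 1)) ^ p - 1) / (2 * t)) := by
  have hA' := (by fun_prop : Measurable fun (Y : Fin p → Fin n → ℝ) i j => Y j i) hA
  rw [condProb_eq τ h0.le h1.le l hA, condProb_eq τ h0.le h1.le _ hA,
    ← sum_flipLabel_sub_sq hl i]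
  exact colDensity_pi_le_of_rare h0 h1 _ _ hA' ht

theorem condProb_le_flipLabel_of_weak {n p : ℕ} {ε τ : ℝ} (h0 : 0 < ε) (h1 : ε < 1) (i : Fin n)
    {l : Fin n → ℝ} (hl : ∀ k, l k = 1 ∨ l k = -1) {A : Set (Fin n → Fin p → ℝ)}
    (hA : MeasurableSet A) {t : ℝ} (ht : 0 < t) :
    condProb n p ε τ l A ≤ condProb n p ε τ (flipLabel i l) A +
      (t / 2 + ((1 + ε ^ 2 / (1 - ε) * (2 * Real.exp (n * τ ^ 2) * (1 - Real.exp (-(2 * τ ^ 2)))))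
        ^ p - 1) / (2 * t)) := by
  have hA' := (by fun_prop : Measurable fun (Y : Fin p → Fin n → ℝ) i j => Y j i) hA
  rw [condProb_eq τ h0.le h1.le l hA, condProb_eq τ h0.le h1.le _ hA]
  have h := colDensity_pi_le_of_weak h0 h1 (fun k => τ * l k) (fun k => τ * flipLabel i l k)
    hA' ht
  have e : Real.exp (n * τ ^ 2) + Real.exp (n * τ ^ 2) - 2 * Real.exp (n * τ ^ 2 - 2 * τ ^ 2) =
      2 * Real.exp (n * τ ^ 2) * (1 - Real.exp (-(2 * τ ^ 2))) := by
    rw [sub_eq_add_neg (n * τ ^ 2), Real.exp_add]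
    ring
  rwa [sum_label_mul_self hl, sum_label_mul_self (flipLabel_eq_or hl i),
    sum_label_mul_flipLabel hl i, e] at h

theorem half_add_one_add_pow_le {c η : ℝ} {p : ℕ} (hc : 0 ≤ c) (hη : 0 < η)
    (h : p * c ≤ Real.log (1 + η ^ 2)) : η / 2 + ((1 + c) ^ p - 1) / (2 * η) ≤ η := by
  have h1 : (1 + c) ^ p ≤ 1 + η ^ 2 := by
    calc (1 + c) ^ p ≤ Real.exp c ^ p := by
          gcongr
          linarith [Real.add_one_le_exp c]
      _ = Real.exp (p * c) := (Real.exp_nat_mul c p).symm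
      _ ≤ _ := (Real.le_log_iff_exp_le (by positivity)).1 h
  have h2 : ((1 + c) ^ p - 1) / (2 * η) ≤ η / 2 := by
    rw [div_le_div_iff₀ (by positivity) two_pos]
    nlinarith
  linarith

theorem tendsto_natCast_rpow_neg {a : ℝ} (ha : 0 < a) :
    Tendsto (fun p : ℕ => (p : ℝ) ^ (-a)) atTop (nhds 0) :=
  (tendsto_rpow_neg_atTop ha).comp tendsto_natCast_atTop_atTop

theorem tendsto_rare {β α : ℝ} (hα : 0 < α) (h : (1 - β) / 2 < α) :
    Tendsto (fun p : ℕ => (p : ℝ) * ((p : ℝ) ^ (-β) *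
      (Real.exp (4 * ((p : ℝ) ^ (-α)) ^ 2) - 1))) atTop (nhds 0) := by
  have hb := (tendsto_natCast_rpow_neg (a := 2 * α - (1 - β)) (by linarith)).const_mul 8
  rw [mul_zero] at hb
  refine squeeze_zero' (Eventually.of_forall fun p => ?_) ?_ hb
  · have : 0 ≤ Real.exp (4 * ((p : ℝ) ^ (-α)) ^ 2) - 1 :=
      sub_nonneg.2 (Real.one_le_exp (by positivity))
    positivity
  · filter_upwards [(tendsto_natCast_rpow_neg hα).eventually_le_const one_half_pos,
      eventually_gt_atTop 0] with p hp hp0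
    have hp0' : (0 : ℝ) < p := Nat.cast_pos.2 hp0
    have hτ : 0 ≤ (p : ℝ) ^ (-α) := by positivity
    have h1 := (le_abs_self _).trans (Real.abs_exp_sub_one_le (x := 4 * ((p : ℝ) ^ (-α)) ^ 2) (by
      rw [abs_of_nonneg (by positivity)]
      nlinarith))
    rw [abs_of_nonneg (by positivity)] at h1
    calc (p : ℝ) * ((p : ℝ) ^ (-β) * (Real.exp (4 * ((p : ℝ) ^ (-α)) ^ 2) - 1))
        ≤ (p : ℝ) * ((p : ℝ) ^ (-β) * (2 * (4 * ((p : ℝ) ^ (-α)) ^ 2))) := by gcongr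
      _ = 8 * ((p : ℝ) ^ (1 : ℝ) * (p : ℝ) ^ (-β) * ((p : ℝ) ^ (-α) * (p : ℝ) ^ (-α))) := by
        rw [Real.rpow_one]
        ring
      _ = 8 * (p : ℝ) ^ (-(2 * α - (1 - β))) := by
        rw [← Real.rpow_add hp0', ← Real.rpow_add hp0', ← Real.rpow_add hp0']
        ring_nf

theorem nDim_mul_sq_le {θ α : ℝ} (hθ : 0 < θ) (h : θ / 2 < α) {p : ℕ} (hp : 0 < p) :
    (nDim p θ : ℝ) * ((p : ℝ) ^ (-α)) ^ 2 ≤ 2 := by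
  have hp0 : (0 : ℝ) < p := Nat.cast_pos.2 hp
  have hp1 : (1 : ℝ) ≤ p := Nat.one_le_cast.2 hp
  have h1 : (nDim p θ : ℝ) ≤ 2 * (p : ℝ) ^ θ := by
    have := Nat.ceil_lt_add_one (a := (p : ℝ) ^ θ) (by positivity)
    have := Real.one_le_rpow hp1 hθ.le
    unfold nDim
    linarith
  calc (nDim p θ : ℝ) * ((p : ℝ) ^ (-α)) ^ 2
      ≤ 2 * (p : ℝ) ^ θ * ((p : ℝ) ^ (-α)) ^ 2 := by gcongr
    _ = 2 * (p : ℝ) ^ (θ + -α + -α) := by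
      rw [Real.rpow_add hp0, Real.rpow_add hp0]
      ring
    _ ≤ 2 * 1 := by
      gcongr
      exact Real.rpow_le_one_of_one_le_of_nonpos hp1 (by linarith)
    _ = 2 := mul_one 2

theorem tendsto_weak {θ β α : ℝ} (hθ : 0 < θ) (hβ : 0 < β) (h : θ / 2 < α)
    (h' : (1 - 2 * β) / 2 < α) :
    Tendsto (fun p : ℕ => (p : ℝ) * (((p : ℝ) ^ (-β)) ^ 2 / (1 - (p : ℝ) ^ (-β)) *
      (2 * Real.exp (nDim p θ * ((p : ℝ) ^ (-α)) ^ 2) *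
        (1 - Real.exp (-(2 * ((p : ℝ) ^ (-α)) ^ 2)))))) atTop (nhds 0) := by
  have hb := (tendsto_natCast_rpow_neg (a := 2 * α - (1 - 2 * β)) (by linarith)).const_mul
    (8 * Real.exp 2)
  rw [mul_zero] at hb
  have hexp : ∀ x : ℝ, 0 ≤ 1 - Real.exp (-(2 * x ^ 2)) := fun x =>
    sub_nonneg.2 (Real.exp_le_one_iff.2 (neg_nonpos.2 (by positivity)))
  have hε := (tendsto_natCast_rpow_neg hβ).eventually_le_const one_half_pos
  refine squeeze_zero' ?_ ?_ hb
  · filter_upwards [hε] with p hp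
    have h1 : 0 ≤ 1 - (p : ℝ) ^ (-β) := by linarith
    have := hexp ((p : ℝ) ^ (-α))
    positivity
  · filter_upwards [hε, eventually_gt_atTop 0] with p hp hp0
    have hp0' : (0 : ℝ) < p := Nat.cast_pos.2 hp0
    have h1 : 1 - Real.exp (-(2 * ((p : ℝ) ^ (-α)) ^ 2)) ≤ 2 * ((p : ℝ) ^ (-α)) ^ 2 := by
      linarith [Real.one_sub_le_exp_neg (2 * ((p : ℝ) ^ (-α)) ^ 2)]
    have h2 : ((p : ℝ) ^ (-β)) ^ 2 / (1 - (p : ℝ) ^ (-β)) ≤ 2 * ((p : ℝ) ^ (-β)) ^ 2 := by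
      rw [div_le_iff₀ (by linarith)]
      nlinarith [sq_nonneg ((p : ℝ) ^ (-β))]
    have h3 := nDim_mul_sq_le hθ h hp0
    have := hexp ((p : ℝ) ^ (-α))
    calc (p : ℝ) * (((p : ℝ) ^ (-β)) ^ 2 / (1 - (p : ℝ) ^ (-β)) *
          (2 * Real.exp (nDim p θ * ((p : ℝ) ^ (-α)) ^ 2) *
            (1 - Real.exp (-(2 * ((p : ℝ) ^ (-α)) ^ 2)))))
        ≤ (p : ℝ) * (2 * ((p : ℝ) ^ (-β)) ^ 2 *
          (2 * Real.exp 2 * (2 * ((p : ℝ) ^ (-α)) ^ 2))) := by gcongr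
      _ = 8 * Real.exp 2 * ((p : ℝ) ^ (1 : ℝ) * ((p : ℝ) ^ (-β) * (p : ℝ) ^ (-β)) *
          ((p : ℝ) ^ (-α) * (p : ℝ) ^ (-α))) := by
        rw [Real.rpow_one]
        ring
      _ = 8 * Real.exp 2 * (p : ℝ) ^ (-(2 * α - (1 - 2 * β))) := by
        rw [← Real.rpow_add hp0', ← Real.rpow_add hp0', ← Real.rpow_add hp0',
          ← Real.rpow_add hp0']
        ring_nf

theorem of_etaClu_lt {θ β α : ℝ} (h : etaClu θ β < α) :
    (1 - β) / 2 < α ∨ θ / 2 < α ∧ (1 - 2 * β) / 2 < α := by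
  unfold etaClu at h
  split_ifs at h
  · exact Or.inr ⟨by linarith, h⟩
  · exact Or.inr ⟨h, by linarith⟩
  · exact Or.inl h

theorem eventually_condProb_le {θ β α η : ℝ} (hθ : 0 < θ) (hβ : 0 < β) (hα : 0 < α)
    (h : etaClu θ β < α) (hη : 0 < η) :
    ∀ᶠ p : ℕ in atTop, ∀ i : Fin (nDim p θ), ∀ l : Fin (nDim p θ) → ℝ,
      (∀ k, l k = 1 ∨ l k = -1) → ∀ A, MeasurableSet A →
      condProb (nDim p θ) p ((p : ℝ) ^ (-β)) ((p : ℝ) ^ (-α)) l A ≤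
        condProb (nDim p θ) p ((p : ℝ) ^ (-β)) ((p : ℝ) ^ (-α)) (flipLabel i l) A + η := by
  have hlog : 0 < Real.log (1 + η ^ 2) := Real.log_pos (by nlinarith)
  have hε := (tendsto_natCast_rpow_neg hβ).eventually_lt_const one_pos
  rcases of_etaClu_lt h with h | ⟨h, h'⟩
  · filter_upwards [hε, eventually_gt_atTop 0,
      (tendsto_rare hα h).eventually_le_const hlog] with p hp hp0 hpc i l hl A hA
    have hp0' : (0 : ℝ) < p := Nat.cast_pos.2 hp0
    refine (condProb_le_flipLabel_of_rare (by positivity) hp i hl hA hη).trans ?_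
    gcongr
    refine half_add_one_add_pow_le (mul_nonneg (by positivity) (sub_nonneg.2 ?_)) hη hpc
    exact Real.one_le_exp (by positivity)
  · filter_upwards [hε, eventually_gt_atTop 0,
      (tendsto_weak hθ hβ h h').eventually_le_const hlog] with p hp hp0 hpc i l hl A hA
    have hp0' : (0 : ℝ) < p := Nat.cast_pos.2 hp0
    refine (condProb_le_flipLabel_of_weak (by positivity) hp i hl hA hη).trans ?_
    gcongr
    refine half_add_one_add_pow_le (mul_nonneg (div_nonneg (by positivity) (by linarith))
      (mul_nonneg (by positivity) (sub_nonneg.2 ?_))) hη hpc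
    exact Real.exp_le_one_iff.2 (neg_nonpos.2 (by positivity))

end ARWPaper

open ARWPaper in
/-- statistical lower bound for clustering. If `α > η^clu_θ(β)` then no
sequence of measurable clustering procedures can do better than random guessing:
`liminf_p Hamm_p(ℓ̂) ≥ 1/2`. -/
theorem clustering_statistical_lower_bound
    (θ β α : ℝ) (hθ0 : 0 < θ) (hθ1 : θ < 1) (hβ0 : 0 < β) (hβ1 : β < 1)
    (hα : 0 < α) (hmain : etaClu θ β < α)
    (ell : (p : ℕ) → (Fin (nDim p θ) → Fin p → ℝ) → Fin (nDim p θ) → ℝ)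
    (hmeas : ∀ p, Measurable (ell p))
    (hval : ∀ p X i, ell p X i = 1 ∨ ell p X i = -1) :
    (1 / 2 : ℝ) ≤ Filter.liminf
      (fun p : ℕ =>
        hammingClu (nDim p θ) p ((p : ℝ) ^ (-β)) ((p : ℝ) ^ (-α)) dataMap (ell p))
      Filter.atTop := by
  have hε : ∀ᶠ p : ℕ in atTop, (p : ℝ) ^ (-β) ≤ 1 :=
    (tendsto_natCast_rpow_neg hβ0).eventually_le_const one_pos
  have hcobdd : IsCoboundedUnder (· ≥ ·) atTop fun p : ℕ =>
      hammingClu (nDim p θ) p ((p : ℝ) ^ (-β)) ((p : ℝ) ^ (-α)) dataMap (ell p) :=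
    IsBoundedUnder.isCoboundedUnder_ge ⟨1, eventually_map.2 (by
      filter_upwards [hε] with p hp
      exact hammingClu_le_one (by positivity) hp _ _)⟩
  refine le_of_forall_pos_sub_le fun η hη => le_liminf_of_le hcobdd ?_
  filter_upwards [hε, eventually_gt_atTop 0,
    eventually_condProb_le hθ0 hβ0 hα hmain (mul_pos two_pos hη)] with p hp hp0 hTV
  have hn : 0 < nDim p θ :=
    Nat.ceil_pos.2 (Real.rpow_pos_of_pos (Nat.cast_pos.2 hp0) _)
  have := half_sub_le_hammingClu hn (by positivity) hp (by positivity) hTV (ell p) (hmeas p)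
    (hval p)
  linarith
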